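/- For every point I of ℂP², the fundamental group of the space 𝒫_I of Pappus configurations with intersection point I (at any basepoint) is isomorphic to the direct product PB₃ × F₂, where PB₃ is the group presented by generators α₁₂, α₁₃, α₂₃ subject to the relations α₁₂α₁₃α₂₃ = α₁₃α₂₃α₁₂ = α₂₃α₁₂α₁₃ (the pure braid group on three strands), and F₂ is the free group on two generators. -/

import Mathlib

noncomputable section

open Module Submodule

/-- Topology on the projectivization (quotient topology). -/
instance (K V : Type*) [DivisionRing K] [AddCommGroup V] [Module K V] [TopologicalSpace V] :
    TopologicalSpace (Projectivization K V) :=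
  inferInstanceAs (TopologicalSpace (Quotient (projectivizationSetoid K V)))

/-- The complex projective space `ℂP^n`. -/
abbrev CP (n : ℕ) := Projectivization ℂ (Fin (n + 1) → ℂ)

/-- `Fconf k i n` is the ordered configuration space `F_k^{i,n}` of `k` pairwise distinct
points of `ℂP^n` whose projective span has dimension `i` (i.e. the span of representative
vectors has linear dimension `i + 1`). -/
def Fconf (k i n : ℕ) : Set (Fin k → CP n) :=
  {x | Function.Injective x ∧
    finrank ℂ (span ℂ (Set.range fun j => (x j).rep)) = i + 1}

/-- The linear span of the representatives of three of the six points of a tuple. -/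
def lineSpan (n : ℕ) (x : Fin 6 → CP n) (a b c : Fin 6) :
    Submodule ℂ (Fin (n + 1) → ℂ) :=
  Submodule.span ℂ {(x a).rep, (x b).rep, (x c).rep}

/-- The space of Pappus configurations in `ℂP^n`: 6-tuples `(A₁, B₁, C₁, A₂, B₂, C₂)` of
pairwise distinct points spanning a projective subspace of dimension `2`, such that each
triple `(Aᵢ, Bᵢ, Cᵢ)` spans a projective line `dᵢ`, and no point of the configuration lies
on both lines (i.e. none equals the intersection point `I = d₁ ∩ d₂`). -/
def PappusSet (n : ℕ) : Set (Fin 6 → CP n) :=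
  {x | Function.Injective x ∧
    finrank ℂ (span ℂ (Set.range fun i => (x i).rep)) = 3 ∧
    finrank ℂ (lineSpan n x 0 1 2) = 2 ∧
    finrank ℂ (lineSpan n x 3 4 5) = 2 ∧
    ∀ i, (x i).rep ∉ lineSpan n x 0 1 2 ⊓ lineSpan n x 3 4 5}

/-- The space `𝒫_I` of Pappus configurations in `ℂP²` whose two lines meet exactly
in the fixed point `I`. -/
def PappusISet (I : CP 2) : Set (Fin 6 → CP 2) :=
  {x | x ∈ PappusSet 2 ∧
    lineSpan 2 x 0 1 2 ⊓ lineSpan 2 x 3 4 5 = Projectivization.submodule I}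

/-- The relators of the pure braid group `PB₃` on the generators `α₁₂, α₁₃, α₂₃`
(indexed by `0, 1, 2`): `α₁₂α₁₃α₂₃ = α₁₃α₂₃α₁₂ = α₂₃α₁₂α₁₃`. -/
def PB3Rels : Set (FreeGroup (Fin 3)) :=
  {FreeGroup.of 0 * FreeGroup.of 1 * FreeGroup.of 2 *
      (FreeGroup.of 1 * FreeGroup.of 2 * FreeGroup.of 0)⁻¹,
   FreeGroup.of 0 * FreeGroup.of 1 * FreeGroup.of 2 *
      (FreeGroup.of 2 * FreeGroup.of 0 * FreeGroup.of 1)⁻¹}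

section FundamentalGroupOfCover

variable {X : Type*} [TopologicalSpace X]

/-- In a simply connected set, any two paths with the same endpoints are homotopic. -/
theorem IsSimplyConnected.mk_eq_mk {U : Set X} (hU : IsSimplyConnected U) {x y : X}
    (p q : Path x y) (hp : ∀ t, p t ∈ U) (hq : ∀ t, q t ∈ U) :
    Path.Homotopic.Quotient.mk p = Path.Homotopic.Quotient.mk q := by
  have := hU.simplyConnectedSpace
  have hx : x ∈ U := by simpa using hp 0
  have hy : y ∈ U := by simpa using hp 1
  let p' : Path (⟨x, hx⟩ : U) ⟨y, hy⟩ := ⟨⟨fun t => ⟨p t, hp t⟩, by fun_prop⟩, by simp, by simp⟩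
  let q' : Path (⟨x, hx⟩ : U) ⟨y, hy⟩ := ⟨⟨fun t => ⟨q t, hq t⟩, by fun_prop⟩, by simp, by simp⟩
  exact Path.Homotopic.Quotient.eq.2 ((SimplyConnectedSpace.paths_homotopic p' q').map
    ⟨Subtype.val, continuous_subtype_val⟩)

/-- The homotopy class of paths between two points running inside a simply connected set. -/
def IsSimplyConnected.pathClass {U : Set X} (hU : IsSimplyConnected U) {x y : X}
    (hx : x ∈ U) (hy : y ∈ U) : Path.Homotopic.Quotient x y :=
  Path.Homotopic.Quotient.mk (hU.isPathConnected.joinedIn x hx y hy).somePath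

theorem IsSimplyConnected.mk_eq_pathClass {U : Set X} (hU : IsSimplyConnected U) {x y : X}
    (hx : x ∈ U) (hy : y ∈ U) (p : Path x y) (hp : ∀ t, p t ∈ U) :
    Path.Homotopic.Quotient.mk p = hU.pathClass hx hy :=
  hU.mk_eq_mk _ _ hp (hU.isPathConnected.joinedIn x hx y hy).somePath_mem

theorem IsSimplyConnected.pathClass_trans_mk {U : Set X} (hU : IsSimplyConnected U) {x y z : X}
    (hx : x ∈ U) (hy : y ∈ U) (hz : z ∈ U) (p : Path y z) (hp : ∀ t, p t ∈ U) :
    (hU.pathClass hx hy).trans (Path.Homotopic.Quotient.mk p) = hU.pathClass hx hz := by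
  rw [IsSimplyConnected.pathClass, ← Path.Homotopic.Quotient.mk_trans]
  refine hU.mk_eq_pathClass hx hz _ fun t => ?_
  have ht : ((hU.isPathConnected.joinedIn x hx y hy).somePath.trans p) t ∈
      Set.range ((hU.isPathConnected.joinedIn x hx y hy).somePath.trans p) := ⟨t, rfl⟩
  rw [Path.trans_range] at ht
  rcases ht with ⟨s, hs⟩ | ⟨s, hs⟩
  · exact hs ▸ (hU.isPathConnected.joinedIn x hx y hy).somePath_mem s
  · exact hs ▸ hp s

theorem IsSimplyConnected.pathClass_self {U : Set X} (hU : IsSimplyConnected U) {x : X}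
    (hx : x ∈ U) : hU.pathClass hx hx = Path.Homotopic.Quotient.refl x :=
  (hU.mk_eq_pathClass hx hx (Path.refl x) fun _ => hx).symm

/-- If a space is covered by simply connected open sets containing the base point, then the
fundamental group is generated by the loops that run from the base point to a point in an
intersection inside one member of the cover and back inside another one. -/
theorem FundamentalGroup.eq_top_of_cover {ι : Type*} {U : ι → Set X} (hU : ∀ i, IsOpen (U i))
    (hsc : ∀ i, IsSimplyConnected (U i)) (hcov : ∀ x, ∃ i, x ∈ U i) {x₀ : X}
    (hx₀ : ∀ i, x₀ ∈ U i) (H : Subgroup (FundamentalGroup X x₀))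
    (hH : ∀ i j y (hi : y ∈ U i) (hj : y ∈ U j), FundamentalGroup.fromPath
      (((hsc i).pathClass (hx₀ i) hi).trans ((hsc j).pathClass (hx₀ j) hj).symm) ∈ H) :
    H = ⊤ := by
  let P : ∀ y, Path.Homotopic.Quotient x₀ y → Prop := fun y α => ∀ i (hi : y ∈ U i),
    FundamentalGroup.fromPath (α.trans ((hsc i).pathClass (hx₀ i) hi).symm) ∈ H
  have hcast : ∀ {y z} (α : Path.Homotopic.Quotient x₀ y) (h : z = y), P y α →
      P z (α.cast rfl h) := by
    rintro y _ α rfl hα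
    simpa using hα
  have trans_cast : ∀ {x y x' y'} (α : Path.Homotopic.Quotient x₀ x) (γ : Path x y) (hx : x' = x)
      (hy : y' = y), α.trans (.mk γ) =
        ((α.cast rfl hx).trans (.mk (γ.cast hx hy))).cast rfl hy.symm := by
    rintro x y _ _ α γ rfl rfl
    simp
  have step : ∀ {y z} (α : Path.Homotopic.Quotient x₀ y) (δ : Path y z) (j)
      (_ : ∀ t, δ t ∈ U j), P y α → P z (α.trans (.mk δ)) := by
    intro y z α δ j hδ hα i hi
    have hy : y ∈ U j := by simpa using hδ 0
    have hz : z ∈ U j := by simpa using hδ 1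
    have h := mul_mem (hH j i z hz hi) (hα j hy)
    rw [FundamentalGroup.mul_def] at h
    convert h using 1
    rw [← (hsc j).pathClass_trans_mk (hx₀ j) hy hz δ hδ]
    simp only [FundamentalGroup.fromPath, FundamentalGroup.fromArrow]
    generalize (hsc j).pathClass (hx₀ j) hy = w
    generalize ((hsc i).pathClass (hx₀ i) hi).symm = w'
    generalize Path.Homotopic.Quotient.mk δ = d
    grind
  have path : ∀ {x y} (γ : Path x y) (α : Path.Homotopic.Quotient x₀ x), P x α →
      P y (α.trans (.mk γ)) := by
    intro x y γ α hα
    obtain ⟨t, ht0, htm, ⟨n, hn⟩, ht⟩ := exists_monotone_Icc_subset_open_cover_unitInterval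
      (fun i => (hU i).preimage γ.continuous) (fun s _ => by simpa using hcov (γ s))
    have key : ∀ m, P _ ((α.cast rfl γ.source).trans (.mk (γ.subpath 0 (t m)))) := by
      intro m
      induction m with
      | zero =>
        rw [ht0, Path.subpath_self, Path.Homotopic.Quotient.mk_refl,
          Path.Homotopic.Quotient.trans_refl]
        exact hcast _ γ.source hα
      | succ m ih =>
        obtain ⟨j, hj⟩ := ht m
        have := step _ (γ.subpath (t m) (t (m + 1))) j ?_ ih
        · rw [Path.Homotopic.Quotient.trans_assoc, ← Path.Homotopic.Quotient.mk_trans,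
            Path.Homotopic.Quotient.eq.2 ⟨Path.Homotopy.subpathTransSubpath γ _ _ _⟩] at this
          exact this
        · intro s
          have hs := Set.mem_range_self (f := γ.subpath (t m) (t (m + 1))) s
          rw [Path.range_subpath_of_le _ _ _ (htm m.le_succ)] at hs
          obtain ⟨r, hr, hrs⟩ := hs
          exact hrs ▸ hj hr
    have := key n
    rw [hn n le_rfl, Path.subpath_zero_one] at this
    have := hcast _ γ.target.symm this
    convert this using 1
    exact trans_cast α _ _ _
  rw [eq_top_iff]
  rintro g -
  induction g using Path.Homotopic.Quotient.ind with | mk γ =>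
  obtain ⟨i, hi⟩ := hcov x₀
  have refl_symm : (Path.Homotopic.Quotient.refl x₀).symm = .refl x₀ := by
    rw [← Path.Homotopic.Quotient.mk_refl, ← Path.Homotopic.Quotient.mk_symm, Path.refl_symm]
  have h := path γ (.refl x₀) (fun i hi => ?_) i hi
  · simpa only [IsSimplyConnected.pathClass_self, refl_symm, Path.Homotopic.Quotient.trans_refl,
      Path.Homotopic.Quotient.refl_trans] using h
  · rw [IsSimplyConnected.pathClass_self, refl_symm, Path.Homotopic.Quotient.trans_refl]
    exact one_mem H

/-- A space covered by two simply connected open sets with path connected intersection is simply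
connected: its fundamental group is trivial. -/
theorem FundamentalGroup.subsingleton_of_union {U V : Set X} (hU : IsOpen U) (hV : IsOpen V)
    (hUs : IsSimplyConnected U) (hVs : IsSimplyConnected V) (hcov : ∀ x, x ∈ U ∨ x ∈ V)
    (hUV : IsPathConnected (U ∩ V)) (x₀ : X) : Subsingleton (FundamentalGroup X x₀) := by
  obtain ⟨b, hbU, hbV⟩ := hUV.nonempty
  let T : Bool → Set X := fun c => cond c U V
  have hT : ∀ c, IsSimplyConnected (T c) := by rintro (_ | _) <;> assumption
  have hb : ∀ c, b ∈ T c := by rintro (_ | _) <;> assumption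
  have hTo : ∀ c, IsOpen (T c) := by rintro (_ | _) <;> assumption
  have hbot := FundamentalGroup.eq_top_of_cover hTo hT
    (fun x => (hcov x).elim (fun h => ⟨true, h⟩) (fun h => ⟨false, h⟩)) hb ⊥ ?_
  · have hsub : Subsingleton (FundamentalGroup X b) := by
      rw [← Subgroup.subsingleton_iff (G := FundamentalGroup X b)]
      exact subsingleton_of_bot_eq_top hbot
    have : PathConnectedSpace X := by
      rw [pathConnectedSpace_iff_univ]
      convert hUs.isPathConnected.union hVs.isPathConnected hUV.nonempty
      exact (Set.eq_univ_of_forall hcov).symm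
    exact (FundamentalGroup.fundamentalGroupMulEquivOfPathConnected x₀ b).toEquiv.subsingleton
  · have same : ∀ i j y (hi : y ∈ T i) (hj : y ∈ T j) (_ : y ∈ U ∩ V),
        (hT i).pathClass (hb i) hi = (hT j).pathClass (hb j) hj := by
      intro i j y hi hj hy
      have hJ := hUV.joinedIn b ⟨hbU, hbV⟩ y hy
      have hm : ∀ c t, hJ.somePath t ∈ T c := by
        rintro (_ | _) t
        exacts [(hJ.somePath_mem t).2, (hJ.somePath_mem t).1]
      rw [← (hT i).mk_eq_pathClass (hb i) hi _ (hm i), (hT j).mk_eq_pathClass (hb j) hj _ (hm j)]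
    intro i j y hi hj
    have : (hT i).pathClass (hb i) hi = (hT j).pathClass (hb j) hj := by
      rcases i with _ | _ <;> rcases j with _ | _
      · rfl
      · exact same _ _ _ hi hj ⟨hj, hi⟩
      · exact same _ _ _ hi hj ⟨hi, hj⟩
      · rfl
    rw [this, Path.Homotopic.Quotient.trans_symm]
    exact one_mem (⊥ : Subgroup (FundamentalGroup X b))

end FundamentalGroupOfCover

section LocalSystem

variable {X ι F : Type*} [TopologicalSpace X] [TopologicalSpace F]

/-- The point of the total space of a fiber bundle core with given coordinates in a chart. -/
def FiberBundleCore.chartPoint (Z : FiberBundleCore ι X F) (i : ι) (x : X) (h : F) :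
    Z.proj ⁻¹' {x} :=
  ⟨⟨x, Z.coordChange i (Z.indexAt x) x h⟩, rfl⟩

theorem FiberBundleCore.chartPoint_eq (Z : FiberBundleCore ι X F) {i j : ι} {x : X}
    (hi : x ∈ Z.baseSet i) (hj : x ∈ Z.baseSet j) (h : F) :
    Z.chartPoint i x h = Z.chartPoint j x (Z.coordChange i j x h) := by
  unfold chartPoint
  rw [Z.coordChange_comp _ _ _ _ ⟨⟨hi, hj⟩, Z.mem_baseSet_at x⟩]

theorem FiberBundleCore.chartPoint_injective (Z : FiberBundleCore ι X F) {i : ι} {x : X}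
    (hi : x ∈ Z.baseSet i) : Function.Injective (Z.chartPoint i x) := by
  intro h h' e
  have e' : Z.coordChange i (Z.indexAt x) x h = Z.coordChange i (Z.indexAt x) x h' := by
    have := congrArg Subtype.val e
    simp only [chartPoint] at this
    exact eq_of_heq (Bundle.TotalSpace.mk.inj this).2
  have := congrArg (Z.coordChange (Z.indexAt x) i x) e'
  rwa [Z.coordChange_comp _ _ _ _ ⟨⟨hi, Z.mem_baseSet_at x⟩, hi⟩,
    Z.coordChange_comp _ _ _ _ ⟨⟨hi, Z.mem_baseSet_at x⟩, hi⟩, Z.coordChange_self _ _ hi,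
    Z.coordChange_self _ _ hi] at this

theorem FiberBundleCore.continuousOn_chartPoint (Z : FiberBundleCore ι X F) (i : ι) (h : F) :
    ContinuousOn (fun x => (Z.chartPoint i x h).1) (Z.baseSet i) :=
  (Z.localTriv i).toOpenPartialHomeomorph.continuousOn_symm.comp
    (Continuous.prodMk continuous_id continuous_const).continuousOn
    fun _ hx => (Z.localTriv i).mem_target.2 hx

/-- Parallel transport along a path inside a chart of a bundle with discrete fiber is constant in
the coordinates of that chart. -/
theorem FiberBundleCore.monodromy_chartPoint (Z : FiberBundleCore ι X F)
    (cov : IsCoveringMap Z.proj) (i : ι) {y z : X} (p : Path y z)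
    (hp : ∀ t, p t ∈ Z.baseSet i) (h : F) :
    cov.monodromy (.mk p) (Z.chartPoint i y h) = Z.chartPoint i z h := by
  let Γ : Path (Z.chartPoint i y h).1 (Z.chartPoint i z h).1 :=
    ⟨⟨fun t => (Z.chartPoint i (p t) h).1,
      (Z.continuousOn_chartPoint i h).comp_continuous p.continuous hp⟩,
      by dsimp; rw [p.source], by dsimp; rw [p.target]⟩
  exact cov.monodromy_map (.mk Γ)

/-- The discrete local system with holonomy prescribed by `g`, on a space with an open cover
`U i` whose pairwise intersections consist of two pieces `P` and `N`: the charts agree over `P`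
and differ by left translations over `N`. -/
def FiberBundleCore.ofTwoPieces {G : Type*} [Group G] [TopologicalSpace G] [DiscreteTopology G]
    {U : ι → Set X} (hU : ∀ i, IsOpen (U i)) (hcov : ∀ x, ∃ i, x ∈ U i) {P N : Set X}
    (hP : IsOpen P) (hN : IsOpen N) (hPN : Disjoint P N)
    (hinter : ∀ i j, i ≠ j → U i ∩ U j ⊆ P ∪ N) (g : ι → G) : FiberBundleCore ι X G where
  baseSet := U
  isOpen_baseSet := hU
  indexAt x := (hcov x).choose
  mem_baseSet_at x := (hcov x).choose_spec
  coordChange i j x h := open Classical in if x ∈ N then (g j)⁻¹ * g i * h else h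
  coordChange_self i x _ h := by simp
  continuousOn_coordChange i j := by
    classical
    rcases eq_or_ne i j with rfl | hij
    · simpa using continuousOn_snd
    · rintro ⟨x, h⟩ ⟨hx, -⟩
      refine ContinuousAt.continuousWithinAt ?_
      rcases hinter i j hij hx with hx | hx
      · refine continuousAt_snd.congr ?_
        filter_upwards [(hP.preimage continuous_fst).mem_nhds (show (x, h) ∈ Prod.fst ⁻¹' P from hx)]
          with q hq
        simp [hPN.notMem_of_mem_left hq]
      · refine ContinuousAt.congr (f := fun q : X × G => (g j)⁻¹ * g i * q.2)
          ((continuous_of_discreteTopology (f := fun h : G => (g j)⁻¹ * g i * h)).comp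
            continuous_snd).continuousAt ?_
        filter_upwards [(hN.preimage continuous_fst).mem_nhds (show (x, h) ∈ Prod.fst ⁻¹' N from hx)]
          with q hq
        exact (if_pos hq).symm
  coordChange_comp i j k x _ h := by
    split_ifs <;> group

end LocalSystem

section FreeFundamentalGroup

variable {X κ : Type*} [TopologicalSpace X]

theorem Path.Homotopic.Quotient.trans_trans_symm_trans {x y z w : X}
    (a : Path.Homotopic.Quotient x y) (b : Path.Homotopic.Quotient w y)
    (d : Path.Homotopic.Quotient y z) :
    (a.trans d).trans (b.trans d).symm = a.trans b.symm := by
  have h : (b.trans d).symm = d.symm.trans b.symm := by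
    induction b using Path.Homotopic.Quotient.ind with | mk b =>
    induction d using Path.Homotopic.Quotient.ind with | mk d =>
    simp only [← Path.Homotopic.Quotient.mk_trans, ← Path.Homotopic.Quotient.mk_symm,
      Path.trans_symm]
  rw [h]
  grind

/-- Suppose a space is covered by simply connected open sets, indexed by `Option κ`, which all
contain two disjoint path connected open sets `P` and `N` and meet pairwise exactly in `P ∪ N`.
Then its fundamental group is free on `κ`. -/
theorem FundamentalGroup.nonempty_mulEquiv_freeGroup {U : Option κ → Set X}
    (hU : ∀ i, IsOpen (U i)) (hsc : ∀ i, IsSimplyConnected (U i)) (hcov : ∀ x, ∃ i, x ∈ U i)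
    {P N : Set X} (hP : IsOpen P) (hN : IsOpen N) (hPc : IsPathConnected P)
    (hNc : IsPathConnected N) (hPN : Disjoint P N) (hPU : ∀ i, P ⊆ U i) (hNU : ∀ i, N ⊆ U i)
    (hinter : ∀ i j, i ≠ j → U i ∩ U j ⊆ P ∪ N) {x₀ : X} (hx₀ : x₀ ∈ P) :
    Nonempty (FundamentalGroup X x₀ ≃* FreeGroup κ) := by
  obtain ⟨n₀, hn₀⟩ := hNc.nonempty
  let W : ∀ i, Path.Homotopic.Quotient x₀ n₀ := fun i =>
    (hsc i).pathClass (hPU i hx₀) (hNU i hn₀)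
  let c : κ → FundamentalGroup X x₀ := fun k =>
    FundamentalGroup.fromPath ((W (some k)).trans (W none).symm)
  let Ψ : FreeGroup κ →* FundamentalGroup X x₀ := FreeGroup.lift c
  have hsurj : Function.Surjective Ψ := by
    rw [← MonoidHom.range_eq_top]
    refine FundamentalGroup.eq_top_of_cover hU hsc hcov (fun i => hPU i hx₀) _ ?_
    have hnone : ∀ i, FundamentalGroup.fromPath ((W i).trans (W none).symm) ∈ Ψ.range := by
      rintro (_ | k)
      · rw [Path.Homotopic.Quotient.trans_symm]
        exact one_mem Ψ.range
      · exact ⟨FreeGroup.of k, FreeGroup.lift_apply_of⟩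
    have hW : ∀ i j, FundamentalGroup.fromPath ((W i).trans (W j).symm) ∈ Ψ.range := by
      intro i j
      have := mul_mem (inv_mem (hnone j)) (hnone i)
      rw [FundamentalGroup.inv_def, FundamentalGroup.mul_def] at this
      convert this using 1
      exact (Path.Homotopic.Quotient.trans_trans_symm_trans _ _ _).symm
    intro i j y hi hj
    rcases eq_or_ne i j with rfl | hij
    · rw [Path.Homotopic.Quotient.trans_symm]
      exact one_mem Ψ.range
    · rcases hinter i j hij ⟨hi, hj⟩ with hy | hy
      · have hJ := hPc.joinedIn x₀ hx₀ y hy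
        rw [← (hsc i).mk_eq_pathClass _ hi _ fun t => hPU i (hJ.somePath_mem t),
          ← (hsc j).mk_eq_pathClass _ hj _ fun t => hPU j (hJ.somePath_mem t),
          Path.Homotopic.Quotient.trans_symm]
        exact one_mem Ψ.range
      · have hJ := hNc.joinedIn n₀ hn₀ y hy
        rw [← (hsc i).pathClass_trans_mk _ (hNU i hn₀) hi _ fun t => hNU i (hJ.somePath_mem t),
          ← (hsc j).pathClass_trans_mk _ (hNU j hn₀) hj _ fun t => hNU j (hJ.somePath_mem t)]
        rw [Path.Homotopic.Quotient.trans_trans_symm_trans]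
        exact hW i j
  have hinj : Function.Injective Ψ := by
    let : TopologicalSpace (FreeGroup κ) := ⊥
    have : DiscreteTopology (FreeGroup κ) := ⟨rfl⟩
    let Z := FiberBundleCore.ofTwoPieces hU hcov hP hN hPN hinter
      (fun i : Option κ => i.elim 1 FreeGroup.of)
    have cov : IsCoveringMap Z.proj := FiberBundle.isCoveringMap (F := FreeGroup κ) (E := Z.Fiber)
    have hin : ∀ i h, cov.monodromy (W i) (Z.chartPoint i x₀ h) =
        (Z.chartPoint i n₀ h) := fun i h =>
      Z.monodromy_chartPoint cov i _
        ((hsc i).isPathConnected.joinedIn x₀ (hPU i hx₀) n₀ (hNU i hn₀)).somePath_mem h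
    have hout : ∀ i h, cov.monodromy (W i).symm (Z.chartPoint i n₀ h) =
        (Z.chartPoint i x₀ h) := by
      intro i h
      rw [← hin, ← cov.monodromy_trans_apply, Path.Homotopic.Quotient.trans_symm,
        cov.monodromy_refl, id]
    have hc : ∀ k h, cov.monodromyPerm x₀ (c k) (Z.chartPoint none x₀ h) =
        (Z.chartPoint none x₀ (FreeGroup.of k * h)) := by
      intro k h
      have e₁ : Z.chartPoint none x₀ h = Z.chartPoint (some k) x₀ h := by
        rw [Z.chartPoint_eq (hPU _ hx₀) (hPU (some k) hx₀)]
        congr 1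
        exact if_neg (hPN.notMem_of_mem_left hx₀)
      have e₂ : Z.chartPoint (some k) n₀ h = Z.chartPoint none n₀ (FreeGroup.of k * h) := by
        rw [Z.chartPoint_eq (hNU _ hn₀) (hNU none hn₀)]
        congr 1
        refine (if_pos hn₀).trans ?_
        simp
      rw [cov.coe_monodromyPerm]
      refine (cov.monodromy_trans_apply _ _ _).trans ?_
      rw [e₁, hin, e₂, hout]
    have hΨ : ∀ w h, cov.monodromyPerm x₀ (Ψ w) (Z.chartPoint none x₀ h) =
        (Z.chartPoint none x₀ (w * h)) := by
      intro w
      induction w using FreeGroup.induction_on with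
      | C1 =>
        intro h
        rw [map_one, map_one, Equiv.Perm.one_apply, one_mul]
      | of k =>
        intro h
        rw [show Ψ (FreeGroup.of k) = c k from FreeGroup.lift_apply_of]
        exact hc k h
      | inv_of k _ =>
        intro h
        rw [map_inv, map_inv, Equiv.Perm.inv_eq_iff_eq,
          show Ψ (FreeGroup.of k) = c k from FreeGroup.lift_apply_of, hc]
        simp
      | mul a b ha hb =>
        intro h
        rw [map_mul, map_mul, Equiv.Perm.mul_apply, hb, ha, mul_assoc]
    rw [injective_iff_map_eq_one]
    intro w hw
    have := hΨ w 1
    rw [hw, map_one, Equiv.Perm.one_apply] at this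
    simpa using (Z.chartPoint_injective (hPU _ hx₀) this).symm
  exact ⟨(MulEquiv.ofBijective Ψ ⟨hinj, hsurj⟩).symm⟩

end FreeFundamentalGroup

section PuncturedPlanes

theorem StarConvex.isSimplyConnected_preimage_val {E : Type*} [AddCommGroup E] [Module ℝ E]
    [TopologicalSpace E] [ContinuousAdd E] [ContinuousSMul ℝ E] {S T : Set E} {c : E}
    (hT : StarConvex ℝ c T) (hc : c ∈ T) (hTS : T ⊆ S) :
    IsSimplyConnected (Subtype.val ⁻¹' T : Set S) := by
  rw [← Topology.IsEmbedding.subtypeVal.isSimplyConnected_image, Subtype.image_preimage_coe,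
    Set.inter_eq_right.2 hTS]
  have := hT.contractibleSpace ⟨c, hc⟩
  exact SimplyConnectedSpace.ofContractible T

/-- The fundamental group of the plane with the closed pieces of the real line between the open
intervals `J i` removed is free. -/
theorem Complex.nonempty_fundamentalGroup_mulEquiv_freeGroup {κ : Type*} {J : Option κ → Set ℝ}
    (hJo : ∀ i, IsOpen (J i)) (hJc : ∀ i, Convex ℝ (J i)) (hJn : ∀ i, (J i).Nonempty)
    (hJd : ∀ i j, i ≠ j → Disjoint (J i) (J j)) {S : Set ℂ}
    (hS : ∀ z, z ∈ S ↔ z.im ≠ 0 ∨ ∃ i, z.re ∈ J i) (x : S) :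
    Nonempty (FundamentalGroup S x ≃* FreeGroup κ) := by
  let T : Option κ → Set ℂ := fun i => {z | z.im ≠ 0 ∨ z.re ∈ J i}
  have hTo : ∀ i, IsOpen (T i) := fun i =>
    (isOpen_ne_fun Complex.continuous_im continuous_const).union
      ((hJo i).preimage Complex.continuous_re)
  have hTS : ∀ i, T i ⊆ S := fun i z hz => (hS z).2 (hz.imp id fun h => ⟨i, h⟩)
  have hT : ∀ i, IsSimplyConnected (Subtype.val ⁻¹' T i : Set S) := by
    intro i
    obtain ⟨c, hc⟩ := hJn i
    refine StarConvex.isSimplyConnected_preimage_val (c := (c : ℂ)) (fun z hz a b ha hb hab => ?_)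
      (Or.inr (by simpa using hc)) (hTS i)
    simp only [T, Set.mem_ofPred_eq, Complex.add_im, Complex.add_re, Complex.real_smul,
      Complex.re_ofReal_mul, Complex.im_ofReal_mul, Complex.ofReal_re, Complex.ofReal_im] at hz ⊢
    rcases hz with hz | hz
    · rcases eq_or_ne b 0 with rfl | hb
      · right
        obtain rfl : a = 1 := by simpa using hab
        simpa using hc
      · left
        simpa using ⟨hb, hz⟩
    · exact Or.inr (hJc i hc hz ha hb hab)
  have hcov : ∀ x : S, ∃ i, x ∈ (Subtype.val ⁻¹' T i : Set S) := by
    rintro ⟨z, hz⟩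
    rcases (hS z).1 hz with h | ⟨i, h⟩
    exacts [⟨none, Or.inl h⟩, ⟨i, Or.inr h⟩]
  have hPS : {z : ℂ | 0 < z.im} ⊆ S := fun z hz => (hS z).2 (Or.inl (ne_of_gt hz))
  have hNS : {z : ℂ | z.im < 0} ⊆ S := fun z hz => (hS z).2 (Or.inl (ne_of_lt hz))
  have hI : Complex.I ∈ S := hPS (by simp)
  have : PathConnectedSpace S := by
    have hj : ∀ y : S, Joined ⟨Complex.I, hI⟩ y := fun y => by
      obtain ⟨i, hi⟩ := hcov y
      exact ((hT i).isPathConnected.joinedIn _ (Or.inl (by simp)) y hi).joined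
    exact ⟨⟨⟨Complex.I, hI⟩⟩, fun y z => (hj y).symm.trans (hj z)⟩
  obtain ⟨e⟩ := FundamentalGroup.nonempty_mulEquiv_freeGroup
    (fun i => (hTo i).preimage continuous_subtype_val) hT hcov
    (P := Subtype.val ⁻¹' {z : ℂ | 0 < z.im}) (N := Subtype.val ⁻¹' {z : ℂ | z.im < 0})
    ((isOpen_lt continuous_const Complex.continuous_im).preimage continuous_subtype_val)
    ((isOpen_lt Complex.continuous_im continuous_const).preimage continuous_subtype_val)
    (((convex_halfSpace_im_gt 0).isPathConnected ⟨Complex.I, by simp⟩).preimage_coe hPS)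
    (((convex_halfSpace_im_lt 0).isPathConnected ⟨-Complex.I, by simp⟩).preimage_coe hNS)
    (Set.disjoint_left.2 fun z (hz : 0 < z.1.im) (hz' : z.1.im < 0) => lt_asymm hz hz')
    (fun i z hz => Or.inl (ne_of_gt hz)) (fun i z hz => Or.inl (ne_of_lt hz))
    (by
      rintro i j hij z ⟨hi | hi, hj | hj⟩
      iterate 3 exact (lt_or_gt_of_ne (by assumption)).symm
      exact (Set.disjoint_left.1 (hJd i j hij) hi hj).elim)
    (x₀ := ⟨Complex.I, hI⟩) (by simp)
  exact ⟨(FundamentalGroup.fundamentalGroupMulEquivOfPathConnected _ _).trans e⟩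

theorem Complex.nonempty_fundamentalGroup_ne_zero (x : {z : ℂ // z ≠ 0}) :
    Nonempty (FundamentalGroup {z : ℂ // z ≠ 0} x ≃* FreeGroup Unit) := by
  refine Complex.nonempty_fundamentalGroup_mulEquiv_freeGroup (S := {z : ℂ | z ≠ 0})
    (J := fun i : Option Unit => i.elim (Set.Iio 0) fun _ => Set.Ioi 0) ?_ ?_ ?_ ?_ ?_ x
  · rintro (_ | _)
    exacts [isOpen_Iio, isOpen_Ioi]
  · rintro (_ | _)
    exacts [convex_Iio 0, convex_Ioi 0]
  · rintro (_ | _)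
    exacts [Set.nonempty_Iio, Set.nonempty_Ioi]
  · rintro (_ | _) (_ | _) h
    · exact (h rfl).elim
    · exact Set.Ioi_disjoint_Iio_same.symm
    · exact Set.Ioi_disjoint_Iio_same
    · exact (h rfl).elim
  · intro z
    simp only [Set.mem_ofPred_eq, ne_eq, Complex.ext_iff, Complex.zero_re, Complex.zero_im,
      Option.exists, Option.elim, Set.mem_Iio, Set.mem_Ioi, exists_const]
    rw [← ne_iff_lt_or_gt]
    tauto

theorem Complex.nonempty_fundamentalGroup_ne_zero_one (x : {z : ℂ // z ≠ 0 ∧ z ≠ 1}) :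
    Nonempty (FundamentalGroup {z : ℂ // z ≠ 0 ∧ z ≠ 1} x ≃* FreeGroup (Fin 2)) := by
  refine Complex.nonempty_fundamentalGroup_mulEquiv_freeGroup (S := {z : ℂ | z ≠ 0 ∧ z ≠ 1})
    (J := fun i : Option (Fin 2) => i.elim (Set.Iio 0) ![Set.Ioo 0 1, Set.Ioi 1]) ?_ ?_ ?_ ?_ ?_ x
  · simp [Option.forall, Fin.forall_fin_two, isOpen_Iio, isOpen_Ioi, isOpen_Ioo]
  · simp [Option.forall, Fin.forall_fin_two, convex_Iio, convex_Ioi, convex_Ioo]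
  · simp [Option.forall, Fin.forall_fin_two]
  · have h₁ : Disjoint (Set.Iio (0 : ℝ)) (Set.Ioo 0 1) :=
      Set.disjoint_left.2 fun _ h h' => lt_asymm h h'.1
    have h₂ : Disjoint (Set.Iio (0 : ℝ)) (Set.Ioi 1) :=
      (Set.Ioi_disjoint_Iio_of_le zero_le_one).symm
    have h₃ : Disjoint (Set.Ioo (0 : ℝ) 1) (Set.Ioi 1) :=
      Set.disjoint_left.2 fun _ h h' => lt_asymm h.2 h'
    simp [Option.forall, Fin.forall_fin_two, h₁, h₂, h₃, h₁.symm, h₂.symm, h₃.symm]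
  · intro z
    simp only [Set.mem_ofPred_eq, ne_eq, Complex.ext_iff, Complex.zero_re, Complex.zero_im,
      Complex.one_re, Complex.one_im, Option.exists, Fin.exists_fin_two, Option.elim, Set.mem_Iio,
      Set.mem_Ioi, Set.mem_Ioo, Matrix.cons_val_zero, Matrix.cons_val_one]
    constructor
    · rintro ⟨h₀, h₁⟩
      by_contra! h
      rcases lt_trichotomy z.re 0 with h' | h' | h' <;>
        rcases lt_trichotomy z.re 1 with h'' | h'' | h'' <;> grind
    · grind

end PuncturedPlanes

section ComplementOfOrigin

variable {E : Type*} [NormedAddCommGroup E] [NormedSpace ℝ E]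

/-- The complement of the origin in a real vector space of dimension at least three has trivial
fundamental group. -/
theorem subsingleton_fundamentalGroup_ne_zero (hE : 2 < Module.rank ℝ E) (x : {w : E // w ≠ 0}) :
    Subsingleton (FundamentalGroup {w : E // w ≠ 0} x) := by
  let R : E → Set E := fun v => {w | ∀ t : ℝ, 0 ≤ t → w ≠ t • v}
  have hRS : ∀ v, R v ⊆ {w | w ≠ 0} := fun v w hw => by simpa using hw 0 le_rfl
  have hRo : ∀ v, v ≠ 0 → IsOpen (R v) := by
    intro v hv
    convert (((isClosedEmbedding_smul_left (𝕜 := ℝ) hv).isClosedMap _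
      (isClosed_Ici (a := (0 : ℝ)))).isOpen_compl) using 1
    ext w
    simp [R, eq_comm]
  have hR : ∀ v, v ≠ 0 → IsSimplyConnected (Subtype.val ⁻¹' R v : Set {w : E // w ≠ 0}) := by
    intro v hv
    have hmem : -v ∈ R v := by
      intro t ht h
      have : (t + 1) • v = 0 := by rw [add_smul, ← h, one_smul, neg_add_cancel]
      rcases smul_eq_zero.1 this with h | h
      · linarith
      · exact hv h
    refine StarConvex.isSimplyConnected_preimage_val (c := -v) ?_ hmem (hRS v)
    rw [starConvex_iff_forall_pos hmem]
    intro w hw a b ha hb _ t ht h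
    refine hw ((t + a) / b) (by positivity) ?_
    rw [div_eq_inv_mul, mul_smul, eq_inv_smul_iff₀ hb.ne', add_smul, ← h]
    module
  obtain ⟨v, hv⟩ := x
  refine FundamentalGroup.subsingleton_of_union ((hRo v hv).preimage continuous_subtype_val)
    ((hRo (-v) (neg_ne_zero.2 hv)).preimage continuous_subtype_val) (hR v hv)
    (hR (-v) (neg_ne_zero.2 hv)) ?_ ?_ _
  · rintro ⟨w, hw⟩
    by_contra! h
    simp only [Set.mem_preimage, R, Set.mem_ofPred_eq, not_forall, not_not] at h
    obtain ⟨⟨t, ht, rfl⟩, s, hs, h⟩ := h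
    have : (t + s) • v = 0 := by rw [add_smul, h]; simp
    rcases smul_eq_zero.1 this with h | h
    · exact hw (by rw [show t = 0 by linarith, zero_smul])
    · exact hv h
  · have h : R v ∩ R (-v) = ((ℝ ∙ v : Submodule ℝ E) : Set E)ᶜ := by
      ext w
      simp only [R, Set.mem_inter_iff, Set.mem_ofPred_eq, Set.mem_compl_iff, SetLike.mem_coe,
        Submodule.mem_span_singleton, not_exists]
      constructor
      · rintro ⟨h₁, h₂⟩ t rfl
        rcases le_total 0 t with ht | ht
        · exact h₁ t ht rfl
        · exact h₂ (-t) (by linarith) (by simp)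
      · exact fun h => ⟨fun t _ e => h t e.symm, fun t _ e => h (-t) (by simp [e])⟩
    rw [← Set.preimage_inter]
    refine IsPathConnected.preimage_coe (U := {w : E | w ≠ 0}) ?_
      (Set.inter_subset_left.trans (hRS v))
    rw [h]
    apply isPathConnected_compl_of_one_lt_codim
    by_contra! hle
    have h1 : Module.rank ℝ (ℝ ∙ v : Submodule ℝ E) ≤ 1 := rank_span_le _ |>.trans (by simp)
    have := Submodule.rank_quotient_add_rank (ℝ ∙ v : Submodule ℝ E)
    have h2 : Module.rank ℝ E ≤ 1 + 1 := this ▸ add_le_add hle h1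
    rw [one_add_one_eq_two] at h2
    exact absurd hE h2.not_gt

end ComplementOfOrigin

section Functoriality

variable {X Y : Type*} [TopologicalSpace X] [TopologicalSpace Y]

/-- A homeomorphism induces an isomorphism of fundamental groups. -/
def Homeomorph.fundamentalGroupMulEquiv (f : X ≃ₜ Y) (x : X) :
    FundamentalGroup X x ≃* FundamentalGroup Y (f x) :=
  (FundamentalGroupoidFunctor.equivOfHomotopyEquiv
    f.toHomotopyEquiv).fullyFaithfulFunctor.mulEquivEnd (FundamentalGroupoid.mk x)

/-- The fundamental group of a product is the product of the fundamental groups. -/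
def FundamentalGroup.prodMulEquiv (x : X) (y : Y) :
    FundamentalGroup (X × Y) (x, y) ≃* FundamentalGroup X x × FundamentalGroup Y y where
  toFun p := (Path.Homotopic.projLeft p, Path.Homotopic.projRight p)
  invFun q := Path.Homotopic.prod q.1 q.2
  left_inv p := Path.Homotopic.prod_projLeft_projRight p
  right_inv _ := Prod.ext (Path.Homotopic.projLeft_prod _ _) (Path.Homotopic.projRight_prod _ _)
  map_mul' p q := Prod.ext (map_mul (FundamentalGroup.map ⟨Prod.fst, continuous_fst⟩ (x, y)) p q)
    (map_mul (FundamentalGroup.map ⟨Prod.snd, continuous_snd⟩ (x, y)) p q)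

/-- A simply connected factor does not change the fundamental group of a product. -/
def FundamentalGroup.prodMulEquivRight (x : X) (y : Y) [Subsingleton (FundamentalGroup X x)] :
    FundamentalGroup (X × Y) (x, y) ≃* FundamentalGroup Y y :=
  have : Unique (FundamentalGroup X x) := uniqueOfSubsingleton 1
  (FundamentalGroup.prodMulEquiv x y).trans MulEquiv.uniqueProd

end Functoriality

section PureBraidGroup

/-- The pure braid group on three strands splits as the product of its infinite cyclic center and
a free group of rank two. -/
theorem nonempty_PB3_mulEquiv :
    Nonempty (PresentedGroup PB3Rels ≃* FreeGroup Unit × FreeGroup (Fin 2)) := by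
  let gen : Fin 3 → PresentedGroup PB3Rels := PresentedGroup.of
  have h₁ : gen 0 * gen 1 * gen 2 = gen 1 * gen 2 * gen 0 :=
    PresentedGroup.mk_eq_mk_of_mul_inv_mem (Or.inl rfl)
  have h₂ : gen 0 * gen 1 * gen 2 = gen 2 * gen 0 * gen 1 :=
    PresentedGroup.mk_eq_mk_of_mul_inv_mem (Or.inr rfl)
  have hz : ∀ g, Commute (gen 0 * gen 1 * gen 2) g := by
    have h : (⊤ : Subgroup (PresentedGroup PB3Rels)) ≤
        Subgroup.centralizer {gen 0 * gen 1 * gen 2} := by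
      rw [← PresentedGroup.closure_range_of, Subgroup.closure_le]
      rintro _ ⟨i, rfl⟩
      rw [SetLike.mem_coe, Subgroup.mem_centralizer_singleton_iff]
      change gen i * _ = _ * gen i
      fin_cases i
      · change gen 0 * (gen 0 * gen 1 * gen 2) = gen 0 * gen 1 * gen 2 * gen 0
        nth_rw 1 [h₁]
        simp only [mul_assoc]
      · change gen 1 * (gen 0 * gen 1 * gen 2) = gen 0 * gen 1 * gen 2 * gen 1
        nth_rw 1 [h₂]
        rw [h₁]
        simp only [mul_assoc]
      · change gen 2 * (gen 0 * gen 1 * gen 2) = gen 0 * gen 1 * gen 2 * gen 2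
        nth_rw 2 [h₂]
        simp only [mul_assoc]
    intro g
    exact ((Subgroup.mem_centralizer_singleton_iff).1 (h (Subgroup.mem_top g))).symm
  let f : Fin 3 → FreeGroup Unit × FreeGroup (Fin 2) :=
    ![(1, .of 0), (1, .of 1), (.of (), (.of 0 * .of 1)⁻¹)]
  have hf : ∀ r ∈ PB3Rels, FreeGroup.lift f r = 1 := by
    rintro _ (rfl | rfl) <;> simp [f, mul_assoc]
  have hcomm : ∀ (m : FreeGroup Unit) (n : FreeGroup (Fin 2)),
      Commute (FreeGroup.lift (fun _ => gen 0 * gen 1 * gen 2) m)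
        (FreeGroup.lift ![gen 0, gen 1] n) := by
    intro m n
    induction m using FreeGroup.induction_on with
    | C1 => simp
    | of _ => simpa using hz _
    | inv_of _ _ => simpa using (hz _).inv_left
    | mul _ _ h h' => simpa using h.mul_left h'
  refine ⟨MonoidHom.toMulEquiv (PresentedGroup.toGroup hf)
    (MonoidHom.noncommCoprod _ _ hcomm) ?_ ?_⟩
  · refine PresentedGroup.ext fun i => ?_
    rw [MonoidHom.comp_apply, PresentedGroup.toGroup.of]
    fin_cases i
    · simp [f, gen]
    · simp [f, gen]
    · change MonoidHom.noncommCoprod _ _ hcomm (f 2) = gen 2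
      simp [f, h₂, mul_assoc]
  · have h : ∀ i, PresentedGroup.toGroup hf (gen i) = f i := fun i => PresentedGroup.toGroup.of hf
    have hl : (PresentedGroup.toGroup hf).comp
        (FreeGroup.lift fun _ => gen 0 * gen 1 * gen 2) = MonoidHom.inl _ _ := by
      refine FreeGroup.ext_hom _ _ fun i => ?_
      simp only [MonoidHom.comp_apply, FreeGroup.lift_apply_of, map_mul, h]
      simp [f]
    have hr : (PresentedGroup.toGroup hf).comp
        (FreeGroup.lift ![gen 0, gen 1]) = MonoidHom.inr _ _ := by
      refine FreeGroup.ext_hom _ _ fun i => ?_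
      rw [MonoidHom.comp_apply, FreeGroup.lift_apply_of]
      fin_cases i
      · exact h 0
      · exact h 1
    refine MonoidHom.ext fun ⟨m, n⟩ => ?_
    have hm := DFunLike.congr_fun hl m
    have hn := DFunLike.congr_fun hr n
    simp only [MonoidHom.comp_apply, MonoidHom.inl_apply, MonoidHom.inr_apply] at hm hn
    simp [MonoidHom.comp_apply, MonoidHom.noncommCoprod_apply, hm, hn]

end PureBraidGroup

section PlaneCoordinates

open scoped ComplexConjugate

/-- The Hermitian form on `ℂ × ℂ`, conjugate-linear in the first variable. -/
def hermProd (w w' : ℂ × ℂ) : ℂ := conj w.1 * w'.1 + conj w.2 * w'.2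

/-- The determinant of a pair of vectors of `ℂ × ℂ`. -/
def crossProd (w w' : ℂ × ℂ) : ℂ := w.1 * w'.2 - w.2 * w'.1

theorem hermProd_self_eq_zero {w : ℂ × ℂ} : hermProd w w = 0 ↔ w = 0 := by
  have h : hermProd w w = ((Complex.normSq w.1 + Complex.normSq w.2 : ℝ) : ℂ) := by
    simp [hermProd, Complex.normSq_eq_conj_mul_self]
  rw [h, Complex.ofReal_eq_zero, add_eq_zero_iff_of_nonneg (Complex.normSq_nonneg _)
    (Complex.normSq_nonneg _), Complex.normSq_eq_zero, Complex.normSq_eq_zero, Prod.ext_iff]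
  rfl

@[fun_prop]
theorem Continuous.hermProd {X : Type*} [TopologicalSpace X] {f g : X → ℂ × ℂ} (hf : Continuous f)
    (hg : Continuous g) : Continuous fun x => hermProd (f x) (g x) := by
  unfold _root_.hermProd
  exact ((Complex.continuous_conj.comp hf.fst).mul hg.fst).add
    ((Complex.continuous_conj.comp hf.snd).mul hg.snd)

@[fun_prop]
theorem Continuous.crossProd {X : Type*} [TopologicalSpace X] {f g : X → ℂ × ℂ}
    (hf : Continuous f) (hg : Continuous g) : Continuous fun x => crossProd (f x) (g x) :=
  (hf.fst.mul hg.snd).sub (hf.snd.mul hg.fst)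

/-- The decomposition of a vector along `w` and its Hermitian orthogonal. -/
theorem eq_smul_add_smul_of_ne_zero {w : ℂ × ℂ} (hw : w ≠ 0) (w' : ℂ × ℂ) :
    (crossProd w w' / hermProd w w) • ((-conj w.2, conj w.1) : ℂ × ℂ) +
      (hermProd w w' / hermProd w w) • w = w' := by
  have h := mt hermProd_self_eq_zero.1 hw
  ext
  · simp only [Prod.fst_add, Prod.smul_fst, smul_eq_mul]
    field_simp
    simp only [hermProd, crossProd]
    ring
  · simp only [Prod.snd_add, Prod.smul_snd, smul_eq_mul]
    field_simp
    simp only [hermProd, crossProd]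
    ring

theorem crossProd_smul_add_smul {w : ℂ × ℂ} (d t : ℂ) :
    crossProd w (d • ((-conj w.2, conj w.1) : ℂ × ℂ) + t • w) = d * hermProd w w := by
  simp only [crossProd, hermProd, Prod.snd_add, Prod.smul_snd, smul_eq_mul, Prod.fst_add,
    Prod.smul_fst]
  ring

theorem hermProd_smul_add_smul {w : ℂ × ℂ} (d t : ℂ) :
    hermProd w (d • ((-conj w.2, conj w.1) : ℂ × ℂ) + t • w) = t * hermProd w w := by
  simp only [hermProd, Prod.snd_add, Prod.smul_snd, smul_eq_mul, Prod.fst_add, Prod.smul_fst]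
  ring

/-- Pairs of independent vectors of `ℂ × ℂ`, in coordinates adapted to the first vector. -/
def independentPairsHomeomorph :
    {p : (ℂ × ℂ) × (ℂ × ℂ) // crossProd p.1 p.2 ≠ 0} ≃ₜ
      {w : ℂ × ℂ // w ≠ 0} × {z : ℂ // z ≠ 0} × ℂ where
  toFun p :=
    have hp : p.1.1 ≠ 0 := fun h => p.2 (by simp [crossProd, h])
    (⟨p.1.1, hp⟩, ⟨crossProd p.1.1 p.1.2 / hermProd p.1.1 p.1.1,
      div_ne_zero p.2 (mt hermProd_self_eq_zero.1 hp)⟩, hermProd p.1.1 p.1.2 / hermProd p.1.1 p.1.1)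
  invFun q := ⟨(q.1.1, q.2.1.1 • ((-conj q.1.1.2, conj q.1.1.1) : ℂ × ℂ) + q.2.2 • q.1.1), by
    rw [crossProd_smul_add_smul]
    exact mul_ne_zero q.2.1.2 (mt hermProd_self_eq_zero.1 q.1.2)⟩
  left_inv p := by
    have hp : p.1.1 ≠ 0 := fun h => p.2 (by simp [crossProd, h])
    exact Subtype.ext (Prod.ext rfl (eq_smul_add_smul_of_ne_zero hp _))
  right_inv q := by
    have h := mt hermProd_self_eq_zero.1 q.1.2
    refine Prod.ext rfl (Prod.ext (Subtype.ext ?_) ?_)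
    · simp only [crossProd_smul_add_smul, mul_div_cancel_right₀ _ h]
    · simp only [hermProd_smul_add_smul, mul_div_cancel_right₀ _ h]
  continuous_toFun := by
    have h : ∀ p : {p : (ℂ × ℂ) × (ℂ × ℂ) // crossProd p.1 p.2 ≠ 0},
        hermProd p.1.1 p.1.1 ≠ 0 := fun p =>
      mt hermProd_self_eq_zero.1 fun h => p.2 (by simp [crossProd, h])
    refine .prodMk (.subtype_mk (by fun_prop) _) (.prodMk (.subtype_mk ?_ _) ?_)
    · exact .div (by fun_prop) (by fun_prop) h
    · exact .div (by fun_prop) (by fun_prop) h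
  continuous_invFun := by
    have hw : Continuous fun q : {w : ℂ × ℂ // w ≠ 0} × {z : ℂ // z ≠ 0} × ℂ => q.1.1 := by
      fun_prop
    have hJ := (Complex.continuous_conj.comp hw.snd).neg.prodMk (Complex.continuous_conj.comp hw.fst)
    have hd : Continuous fun q : {w : ℂ × ℂ // w ≠ 0} × {z : ℂ // z ≠ 0} × ℂ => q.2.1.1 := by
      fun_prop
    exact .subtype_mk (hw.prodMk ((hd.smul hJ).add (continuous_snd.snd.smul hw))) _

end PlaneCoordinates

section ProjectiveTopology

variable {K V : Type*} [DivisionRing K] [AddCommGroup V] [Module K V] [TopologicalSpace V]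

/-- The quotient map onto the projectivization is open. -/
theorem Projectivization.isOpenQuotientMap_mk [ContinuousConstSMul K V] :
    IsOpenQuotientMap fun v : {v : V // v ≠ 0} => Projectivization.mk K v.1 v.2 := by
  refine .of_isOpenMap_isQuotientMap (fun U hU => ?_) isQuotientMap_quotient_mk'
  refine isQuotientMap_quotient_mk'.isOpen_preimage.1 ?_
  have h : (fun v : {v : V // v ≠ 0} => Projectivization.mk K v.1 v.2) ⁻¹'
      ((fun v : {v : V // v ≠ 0} => Projectivization.mk K v.1 v.2) '' U) =
      ⋃ c : Kˣ, (fun v => ⟨c • v.1, (smul_ne_zero_iff_ne c).2 v.2⟩) ⁻¹' U := by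
    ext v
    simp only [Set.mem_preimage, Set.mem_image, Set.mem_iUnion]
    constructor
    · rintro ⟨w, hw, hwv⟩
      obtain ⟨c, hc⟩ := (Projectivization.mk_eq_mk_iff K _ _ w.2 v.2).1 hwv
      exact ⟨c, by convert hw⟩
    · rintro ⟨c, hc⟩
      exact ⟨_, hc, (Projectivization.mk_eq_mk_iff K _ _ _ v.2).2 ⟨c, rfl⟩⟩
  change IsOpen ((fun v : {v : V // v ≠ 0} => Projectivization.mk K v.1 v.2) ⁻¹' _)
  rw [h]
  refine isOpen_iUnion fun c => hU.preimage (.subtype_mk ?_ _)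
  exact continuous_subtype_val.const_smul (c : K)

end ProjectiveTopology

section LinearAlgebra

variable {V : Type*} [AddCommGroup V] [Module ℂ V]

theorem Projectivization.span_rep_mk {K V : Type*} [DivisionRing K] [AddCommGroup V]
    [Module K V] {v : V} (hv : v ≠ 0) : span K {(Projectivization.mk K v hv).rep} = span K {v} := by
  rw [← Projectivization.submodule_eq, Projectivization.submodule_mk]

theorem lineSpan_mk (a : Fin 6 → {v : Fin 3 → ℂ // v ≠ 0}) (i j k : Fin 6) :
    lineSpan 2 (fun i => Projectivization.mk ℂ (a i).1 (a i).2) i j k =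
      span ℂ {(a i).1, (a j).1, (a k).1} := by
  simp only [lineSpan, span_insert, Projectivization.span_rep_mk]

theorem span_range_rep_mk (a : Fin 6 → {v : Fin 3 → ℂ // v ≠ 0}) :
    span ℂ (Set.range fun i => (Projectivization.mk ℂ (a i).1 (a i).2).rep) =
      span ℂ (Set.range fun i => (a i).1) := by
  simp only [span_range_eq_iSup, Projectivization.span_rep_mk]

theorem Projectivization.rep_mk_mem_iff {K V : Type*} [DivisionRing K] [AddCommGroup V]
    [Module K V] {v : V} (hv : v ≠ 0) (W : Submodule K V) :
    (Projectivization.mk K v hv).rep ∈ W ↔ v ∈ W := by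
  rw [← span_singleton_le_iff_mem, Projectivization.span_rep_mk, span_singleton_le_iff_mem]

/-- Membership in `𝒫_I` in terms of homogeneous coordinates. -/
theorem mk_mem_PappusISet_iff {I : CP 2} (a : Fin 6 → {v : Fin 3 → ℂ // v ≠ 0}) :
    (fun i => Projectivization.mk ℂ (a i).1 (a i).2) ∈ PappusISet I ↔
      (∀ i j, i ≠ j → (a i).1 ∉ span ℂ {(a j).1}) ∧
      finrank ℂ (span ℂ (Set.range fun i => (a i).1)) = 3 ∧
      finrank ℂ (span ℂ {(a 0).1, (a 1).1, (a 2).1}) = 2 ∧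
      finrank ℂ (span ℂ {(a 3).1, (a 4).1, (a 5).1}) = 2 ∧
      (∀ i, (a i).1 ∉ span ℂ {I.rep}) ∧
      span ℂ {(a 0).1, (a 1).1, (a 2).1} ⊓ span ℂ {(a 3).1, (a 4).1, (a 5).1} =
        span ℂ {I.rep} := by
  have hinj : Function.Injective (fun i => Projectivization.mk ℂ (a i).1 (a i).2) ↔
      ∀ i j, i ≠ j → (a i).1 ∉ span ℂ {(a j).1} := by
    simp only [Function.Injective, Projectivization.mk_eq_mk_iff', mem_span_singleton]
    exact forall₂_congr fun i j => not_imp_not.symm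
  rw [← span_range_rep_mk a, ← lineSpan_mk a 0 1 2, ← lineSpan_mk a 3 4 5]
  simp only [PappusISet, PappusSet, Set.mem_ofPred_eq, hinj, Projectivization.rep_mk_mem_iff,
    Projectivization.submodule_eq]
  constructor
  · rintro ⟨⟨h₁, h₂, h₃, h₄, h₅⟩, h₆⟩
    exact ⟨h₁, h₂, h₃, h₄, h₆ ▸ h₅, h₆⟩
  · rintro ⟨h₁, h₂, h₃, h₄, h₅, h₆⟩
    exact ⟨⟨h₁, h₂, h₃, h₄, h₆ ▸ h₅⟩, h₆⟩

theorem span_triple_eq_span_pair (u v : V) (z : ℂ) :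
    span ℂ {u, u + v, u + z • v} = span ℂ {u, v} := by
  refine le_antisymm (span_le.2 ?_) (span_le.2 ?_)
  · rintro _ (rfl | rfl | rfl)
    · exact mem_span_pair.2 ⟨1, 0, by simp⟩
    · exact mem_span_pair.2 ⟨1, 1, by simp⟩
    · exact mem_span_pair.2 ⟨1, z, by simp⟩
  · rintro _ (rfl | rfl)
    · exact subset_span (by simp)
    · exact mem_span_triple.2 ⟨-1, 1, 0, by simp⟩

/-- Points on a line through `v`, expressed by one of them and `v`. -/
theorem exists_smul_add_smul_of_finrank_span_eq_two {a b c v : V}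
    (h : finrank ℂ (span ℂ {a, b, c}) = 2) (hv : v ∈ span ℂ {a, b, c}) (hv₀ : v ≠ 0)
    (ha : a ∉ span ℂ {v}) (hb : b ∉ span ℂ {v}) (hc : c ∉ span ℂ {v}) (hba : b ∉ span ℂ {a})
    (hca : c ∉ span ℂ {a}) (hcb : c ∉ span ℂ {b}) :
    span ℂ {a, b, c} = span ℂ {a, v} ∧
    ∃ l m l' m' : ℂ, b = l • a + m • v ∧ c = l' • a + m' • v ∧ l ≠ 0 ∧ m ≠ 0 ∧ l' ≠ 0 ∧ m' ≠ 0 ∧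
      l * m' ≠ m * l' := by
  have hli : LinearIndependent ℂ ![a, v] := by
    rw [LinearIndependent.pair_iff' (fun h₀ => ha (by simp [h₀]))]
    intro r hr
    refine ha (mem_span_singleton.2 ⟨r⁻¹, ?_⟩)
    have : r ≠ 0 := fun h => hv₀ (by rw [← hr, h, zero_smul])
    rw [← hr, inv_smul_smul₀ this]
  have hspan : span ℂ {a, b, c} = span ℂ {a, v} := by
    have : FiniteDimensional ℂ (span ℂ {a, b, c}) := .span_of_finite ℂ (Set.toFinite _)
    symm
    refine eq_of_le_of_finrank_eq (span_le.2 ?_) ?_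
    · rintro _ (rfl | rfl)
      · exact subset_span (by simp)
      · exact hv
    · have := finrank_span_eq_card hli
      rw [Matrix.range_cons, Matrix.range_cons, Matrix.range_empty, Set.union_empty,
        Set.singleton_union, Fintype.card_fin] at this
      rw [h, this]
  refine ⟨hspan, ?_⟩
  obtain ⟨l, m, rfl⟩ := mem_span_pair.1 (hspan ▸ subset_span (by simp) : b ∈ span ℂ {a, v})
  obtain ⟨l', m', rfl⟩ := mem_span_pair.1 (hspan ▸ subset_span (by simp) : c ∈ span ℂ {a, v})
  have hl : l ≠ 0 := by
    rintro rfl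
    exact hb (mem_span_singleton.2 ⟨m, by simp⟩)
  have hl' : l' ≠ 0 := by
    rintro rfl
    exact hc (mem_span_singleton.2 ⟨m', by simp⟩)
  refine ⟨l, m, l', m', rfl, rfl, hl, ?_, hl', ?_, fun heq => ?_⟩
  · rintro rfl
    exact hba (mem_span_singleton.2 ⟨l, by simp⟩)
  · rintro rfl
    exact hca (mem_span_singleton.2 ⟨l', by simp⟩)
  · refine hcb (mem_span_singleton.2 ⟨l' / l, ?_⟩)
    have : m' = l' / l * m := by
      field_simp
      linear_combination heq
    rw [smul_add, smul_smul, smul_smul, div_mul_cancel₀ _ hl, ← this]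

end LinearAlgebra

section LineCoordinates

variable {V : Type*} [AddCommGroup V] [Module ℂ V] [TopologicalSpace V]
  (e : V ≃L[ℂ] ℂ × ℂ × ℂ)

/-- For `b = l • a + m • v` with `e v = (1, 0)`, this is the coefficient `l`. -/
def baseCoeff (a b : V) : ℂ := hermProd (e a).2 (e b).2 / hermProd (e a).2 (e a).2

/-- For `b = l • a + m • v` with `e v = (1, 0)`, this is the coefficient `m`. -/
def apexCoeff (a b : V) : ℂ := (e b).1 - baseCoeff e a b * (e a).1

/-- The multiple `u` of `a` such that `u + v` is a multiple of `b`. -/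
def lineVector (a b : V) : V := (baseCoeff e a b / apexCoeff e a b) • a

/-- The scalar `z` such that `u + z • v` is a multiple of `c`, where `u = lineVector e a b`. -/
def lineScalar (a b c : V) : ℂ :=
  baseCoeff e a b * apexCoeff e a c / (apexCoeff e a b * baseCoeff e a c)

/-- The vectors `a, b, c` represent three distinct points, all distinct from `[v]`, on a line
through `[v]`. -/
structure IsLineTriple (v a b c : V) : Prop where
  snd_ne_zero : (e a).2 ≠ 0
  eq_second : b = baseCoeff e a b • a + apexCoeff e a b • v
  eq_third : c = baseCoeff e a c • a + apexCoeff e a c • v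
  base_second : baseCoeff e a b ≠ 0
  apex_second : apexCoeff e a b ≠ 0
  base_third : baseCoeff e a c ≠ 0
  apex_third : apexCoeff e a c ≠ 0
  cross : baseCoeff e a b * apexCoeff e a c ≠ apexCoeff e a b * baseCoeff e a c

variable {e} {v : V}

theorem snd_ne_zero_of_notMem_span (he : e v = (1, 0)) {a : V} (ha : a ∉ span ℂ {v}) :
    (e a).2 ≠ 0 := by
  intro h
  refine ha (mem_span_singleton.2 ⟨(e a).1, e.injective ?_⟩)
  rw [map_smul, he]
  ext <;> simp [h]

theorem baseCoeff_smul_add_smul (he : e v = (1, 0)) {a : V} (ha : (e a).2 ≠ 0) (l m : ℂ) :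
    baseCoeff e a (l • a + m • v) = l := by
  have h := mt hermProd_self_eq_zero.1 ha
  rw [baseCoeff, div_eq_iff h]
  simp only [hermProd, map_add, map_smul, he, Prod.snd_add, Prod.smul_snd, smul_zero, add_zero,
    Prod.smul_fst, smul_eq_mul]
  ring

theorem apexCoeff_smul_add_smul (he : e v = (1, 0)) {a : V} (ha : (e a).2 ≠ 0) (l m : ℂ) :
    apexCoeff e a (l • a + m • v) = m := by
  rw [apexCoeff, baseCoeff_smul_add_smul he ha]
  simp [he]

theorem isLineTriple_of_finrank_span_eq_two (he : e v = (1, 0)) {a b c : V}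
    (h : finrank ℂ (span ℂ {a, b, c}) = 2) (hv : v ∈ span ℂ {a, b, c})
    (ha : a ∉ span ℂ {v}) (hb : b ∉ span ℂ {v}) (hc : c ∉ span ℂ {v}) (hba : b ∉ span ℂ {a})
    (hca : c ∉ span ℂ {a}) (hcb : c ∉ span ℂ {b}) : IsLineTriple e v a b c := by
  have hv₀ : v ≠ 0 := by
    rintro rfl
    simp [Prod.ext_iff] at he
  have ha' := snd_ne_zero_of_notMem_span he ha
  obtain ⟨-, l, m, l', m', rfl, rfl, hl, hm, hl', hm', hne⟩ :=
    exists_smul_add_smul_of_finrank_span_eq_two h hv hv₀ ha hb hc hba hca hcb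
  have hbase := baseCoeff_smul_add_smul he ha'
  have hapex := apexCoeff_smul_add_smul he ha'
  refine ⟨ha', ?_, ?_, ?_, ?_, ?_, ?_, ?_⟩
  · rw [hbase, hapex]
  · rw [hbase, hapex]
  · rwa [hbase]
  · rwa [hapex]
  · rwa [hbase]
  · rwa [hapex]
  · rwa [hbase, hapex, hbase, hapex]

namespace IsLineTriple

variable {a b c : V}

theorem lineScalar_ne_zero (h : IsLineTriple e v a b c) : lineScalar e a b c ≠ 0 :=
  div_ne_zero (mul_ne_zero h.base_second h.apex_third) (mul_ne_zero h.apex_second h.base_third)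

theorem lineScalar_ne_one (h : IsLineTriple e v a b c) : lineScalar e a b c ≠ 1 := by
  rw [lineScalar, Ne, div_eq_one_iff_eq (mul_ne_zero h.apex_second h.base_third)]
  exact h.cross

theorem lineVector_add (h : IsLineTriple e v a b c) :
    lineVector e a b + v = (apexCoeff e a b)⁻¹ • b := by
  have hm := h.apex_second
  nth_rw 3 [h.eq_second]
  rw [lineVector, smul_add, smul_smul, smul_smul, inv_mul_cancel₀ hm, one_smul, div_eq_inv_mul]

theorem lineVector_add_smul (h : IsLineTriple e v a b c) :
    lineVector e a b + lineScalar e a b c • v =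
      (baseCoeff e a b / (apexCoeff e a b * baseCoeff e a c)) • c := by
  have hm := h.apex_second
  have hl' := h.base_third
  conv_rhs => arg 2; rw [h.eq_third]
  rw [lineVector, lineScalar, smul_add, smul_smul, smul_smul]
  congr 2 <;> field_simp

end IsLineTriple

/-- A point triple on a line through `[v]` determines its normalized coordinates. -/
theorem lineVector_unique (he : e v = (1, 0)) {u u' : V} {z z' : ℂ} (hu : (e u').2 ≠ 0)
    (h₀ : ∃ c : ℂ, c • u' = u) (h₁ : ∃ c : ℂ, c • (u' + v) = u + v)
    (h₂ : ∃ c : ℂ, c • (u' + z' • v) = u + z • v) : u = u' ∧ z = z' := by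
  have key : ∀ r s : ℂ, r • u' = s • v → r = 0 ∧ s = 0 := by
    intro r s h
    have h' := congrArg e h
    rw [map_smul, map_smul, he, Prod.ext_iff] at h'
    have hr : r = 0 := by simpa [hu] using h'.2
    refine ⟨hr, ?_⟩
    have := h'.1
    simpa [hr, eq_comm] using this
  obtain ⟨c, rfl⟩ := h₀
  obtain ⟨d, hd⟩ := h₁
  obtain ⟨f, hf⟩ := h₂
  obtain ⟨hdc, hd₁⟩ := key (d - c) (1 - d) (by linear_combination (norm := module) hd)
  have hc : c = 1 := by linear_combination -hdc - hd₁
  subst hc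
  obtain ⟨hf₁, hfz⟩ := key (f - 1) (z - f * z') (by linear_combination (norm := module) hf)
  refine ⟨one_smul _ _, ?_⟩
  linear_combination hfz + z' * hf₁

theorem linearIndependent_of_crossProd_ne_zero (he : e v = (1, 0)) {u₁ u₂ : V}
    (h : crossProd (e u₁).2 (e u₂).2 ≠ 0) : LinearIndependent ℂ ![u₁, u₂, v] := by
  rw [Fintype.linearIndependent_iff]
  intro g hg
  simp only [Fin.sum_univ_three, Matrix.cons_val_zero, Matrix.cons_val_one, Matrix.cons_val] at hg
  have hg' := congrArg e hg
  simp only [map_add, map_smul, he, map_zero, Prod.ext_iff, Prod.fst_add, Prod.snd_add,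
    Prod.smul_fst, Prod.smul_snd, smul_eq_mul, Prod.fst_zero, Prod.snd_zero, mul_zero, add_zero,
    mul_one] at hg'
  obtain ⟨h₀, h₁, h₂⟩ := hg'
  have hg₀ : g 0 = 0 := by
    refine (mul_eq_zero.1 ?_).resolve_right h
    rw [crossProd]
    linear_combination (e u₂).2.2 * h₁ - (e u₂).2.1 * h₂
  have hg₁ : g 1 = 0 := by
    refine (mul_eq_zero.1 ?_).resolve_right h
    rw [crossProd]
    linear_combination (e u₁).2.1 * h₂ - (e u₁).2.2 * h₁
  have hg₂ : g 2 = 0 := by simpa [hg₀, hg₁] using h₀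
  intro i
  fin_cases i <;> assumption

end LineCoordinates

section PappusVectors

variable {V : Type*} [AddCommGroup V] [Module ℂ V] {u₁ u₂ v : V} {z₁ z₂ : ℂ}

/-- Normalized representatives of a Pappus configuration whose lines meet in `[v]`. -/
def pappusVectors (v u₁ u₂ : V) (z₁ z₂ : ℂ) : Fin 6 → V :=
  ![u₁, u₁ + v, u₁ + z₁ • v, u₂, u₂ + v, u₂ + z₂ • v]

theorem pappusVectors_eq (v u₁ u₂ : V) (z₁ z₂ : ℂ) (i : Fin 6) :
    pappusVectors v u₁ u₂ z₁ z₂ i = (![1, 1, 1, 0, 0, 0] i : ℂ) • u₁ +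
      (![0, 0, 0, 1, 1, 1] i : ℂ) • u₂ + (![0, 1, z₁, 0, 1, z₂] i : ℂ) • v := by
  fin_cases i <;> simp [pappusVectors]

theorem LinearIndependent.eq_zero_of_triple (h : LinearIndependent ℂ ![u₁, u₂, v]) {r s t : ℂ}
    (hr : r • u₁ + s • u₂ + t • v = 0) :
    r = 0 ∧ s = 0 ∧ t = 0 := by
  have := Fintype.linearIndependent_iff.1 h ![r, s, t] (by simpa [Fin.sum_univ_three] using hr)
  exact ⟨this 0, this 1, this 2⟩

theorem pappusVectors_notMem_span (h : LinearIndependent ℂ ![u₁, u₂, v]) (i : Fin 6) :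
    pappusVectors v u₁ u₂ z₁ z₂ i ∉ span ℂ {v} := by
  rw [mem_span_singleton]
  rintro ⟨c, hc⟩
  rw [pappusVectors_eq] at hc
  obtain ⟨h₁, h₂, -⟩ := h.eq_zero_of_triple (r := ![1, 1, 1, 0, 0, 0] i)
    (s := ![0, 0, 0, 1, 1, 1] i) (t := ![0, 1, z₁, 0, 1, z₂] i - c)
    (by linear_combination (norm := module) -hc)
  fin_cases i <;> simp at h₁ h₂

theorem pappusVectors_ne_zero (h : LinearIndependent ℂ ![u₁, u₂, v]) (i : Fin 6) :
    pappusVectors v u₁ u₂ z₁ z₂ i ≠ 0 := fun h₀ =>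
  pappusVectors_notMem_span (z₁ := z₁) (z₂ := z₂) h i (h₀ ▸ zero_mem _)

theorem pappusVectors_notMem_span_of_ne (h : LinearIndependent ℂ ![u₁, u₂, v])
    (hz₁ : z₁ ≠ 0 ∧ z₁ ≠ 1) (hz₂ : z₂ ≠ 0 ∧ z₂ ≠ 1) {i j : Fin 6} (hij : i ≠ j) :
    pappusVectors v u₁ u₂ z₁ z₂ i ∉ span ℂ {pappusVectors v u₁ u₂ z₁ z₂ j} := by
  rw [mem_span_singleton]
  rintro ⟨c, hc⟩
  rw [pappusVectors_eq, pappusVectors_eq] at hc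
  obtain ⟨h₁, h₂, h₃⟩ := h.eq_zero_of_triple
    (r := c * ![1, 1, 1, 0, 0, 0] j - ![1, 1, 1, 0, 0, 0] i)
    (s := c * ![0, 0, 0, 1, 1, 1] j - ![0, 0, 0, 1, 1, 1] i)
    (t := c * ![0, 1, z₁, 0, 1, z₂] j - ![0, 1, z₁, 0, 1, z₂] i)
    (by linear_combination (norm := module) hc)
  have hsum : ∀ k : Fin 6, (![1, 1, 1, 0, 0, 0] k : ℂ) + ![0, 0, 0, 1, 1, 1] k = 1 := by
    intro k
    fin_cases k <;> simp
  have hc₁ : c = 1 := by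
    linear_combination h₁ + h₂ - c * hsum j + hsum i
  subst hc₁
  rw [one_mul, sub_eq_zero] at h₁ h₃
  obtain ⟨hz₁, hz₁'⟩ := hz₁
  obtain ⟨hz₂, hz₂'⟩ := hz₂
  fin_cases i <;> fin_cases j <;>
    first
    | exact hij rfl
    | (simp at h₁; done)
    | simp_all [eq_comm]

theorem finrank_span_pair_left (h : LinearIndependent ℂ ![u₁, u₂, v]) :
    finrank ℂ (span ℂ {u₁, v}) = 2 := by
  have : LinearIndependent ℂ ![u₁, v] := LinearIndependent.pair_iff.2 fun s t hst => by
    obtain ⟨hs, -, ht⟩ := h.eq_zero_of_triple (r := s) (s := 0) (t := t) (by simpa using hst)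
    exact ⟨hs, ht⟩
  have := finrank_span_eq_card this
  rwa [Matrix.range_cons, Matrix.range_cons, Matrix.range_empty, Set.union_empty,
    Set.singleton_union, Fintype.card_fin] at this

theorem span_pair_inf_span_pair (h : LinearIndependent ℂ ![u₁, u₂, v]) :
    span ℂ {u₁, v} ⊓ span ℂ {u₂, v} = span ℂ {v} := by
  refine le_antisymm ?_ (le_inf (span_mono (by simp)) (span_mono (by simp)))
  rintro x ⟨h₁, h₂⟩
  obtain ⟨r, s, rfl⟩ := mem_span_pair.1 h₁
  obtain ⟨r', s', hr⟩ := mem_span_pair.1 h₂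
  obtain ⟨h₀, -, -⟩ := h.eq_zero_of_triple (r := r) (s := -r') (t := s - s')
    (by linear_combination (norm := module) -hr)
  exact mem_span_singleton.2 ⟨s, by simp [h₀]⟩

end PappusVectors

section PappusModel

/-- The parameter space of normalized Pappus configurations: the directions of the two lines,
the heights of the first points of the two triples and the positions of the third points. -/
abbrev PappusModel : Type :=
  {p : (ℂ × ℂ) × (ℂ × ℂ) // crossProd p.1 p.2 ≠ 0} × (ℂ × ℂ) ×
    {z : ℂ // z ≠ 0 ∧ z ≠ 1} × {z : ℂ // z ≠ 0 ∧ z ≠ 1}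

variable {I : CP 2} (e : (Fin 3 → ℂ) ≃L[ℂ] ℂ × ℂ × ℂ)

theorem mk_pappusVectors_mem {u₁ u₂ : Fin 3 → ℂ} {z₁ z₂ : ℂ}
    (h : LinearIndependent ℂ ![u₁, u₂, I.rep]) (hz₁ : z₁ ≠ 0 ∧ z₁ ≠ 1) (hz₂ : z₂ ≠ 0 ∧ z₂ ≠ 1) :
    (fun i => Projectivization.mk ℂ (pappusVectors I.rep u₁ u₂ z₁ z₂ i)
      (pappusVectors_ne_zero h i)) ∈ PappusISet I := by
  have h' : LinearIndependent ℂ ![u₂, u₁, I.rep] := by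
    have := h.comp (Equiv.swap 0 1) (Equiv.injective _)
    convert this using 1
    ext i
    fin_cases i <;> rfl
  rw [mk_mem_PappusISet_iff
    fun i => ⟨pappusVectors I.rep u₁ u₂ z₁ z₂ i, pappusVectors_ne_zero h i⟩]
  have h₁ : span ℂ {u₁, u₁ + I.rep, u₁ + z₁ • I.rep} = span ℂ {u₁, I.rep} :=
    span_triple_eq_span_pair _ _ _
  have h₂ : span ℂ {u₂, u₂ + I.rep, u₂ + z₂ • I.rep} = span ℂ {u₂, I.rep} :=
    span_triple_eq_span_pair _ _ _
  refine ⟨fun i j hij => pappusVectors_notMem_span_of_ne h hz₁ hz₂ hij, ?_, ?_, ?_,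
    pappusVectors_notMem_span h, ?_⟩
  · have hli := finrank_span_eq_card h
    refine le_antisymm ((Submodule.finrank_le _).trans (by simp)) ?_
    refine hli.ge.trans (Submodule.finrank_mono (span_le.2 ?_))
    have hmem : ∀ i, pappusVectors I.rep u₁ u₂ z₁ z₂ i ∈
        span ℂ (Set.range fun i => pappusVectors I.rep u₁ u₂ z₁ z₂ i) :=
      fun i => subset_span ⟨i, rfl⟩
    rintro _ ⟨i, rfl⟩
    fin_cases i
    · exact hmem 0
    · exact hmem 3
    · have := sub_mem (hmem 1) (hmem 0)
      rwa [show pappusVectors I.rep u₁ u₂ z₁ z₂ 1 - pappusVectors I.rep u₁ u₂ z₁ z₂ 0 = I.rep from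
        add_sub_cancel_left _ _] at this
  · change finrank ℂ (span ℂ {u₁, u₁ + I.rep, u₁ + z₁ • I.rep}) = 2
    rw [h₁, finrank_span_pair_left h]
  · change finrank ℂ (span ℂ {u₂, u₂ + I.rep, u₂ + z₂ • I.rep}) = 2
    rw [h₂, finrank_span_pair_left h']
  · change span ℂ {u₁, u₁ + I.rep, u₁ + z₁ • I.rep} ⊓ span ℂ {u₂, u₂ + I.rep, u₂ + z₂ • I.rep} = _
    rw [h₁, h₂, span_pair_inf_span_pair h]

/-- Homogeneous coordinates of a Pappus configuration through `I`. -/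
theorem isLineTriple_of_mem {e : (Fin 3 → ℂ) ≃L[ℂ] ℂ × ℂ × ℂ} (he : e I.rep = (1, 0))
    {a : Fin 6 → {v : Fin 3 → ℂ // v ≠ 0}}
    (ha : (fun i => Projectivization.mk ℂ (a i).1 (a i).2) ∈ PappusISet I) :
    IsLineTriple e I.rep (a 0).1 (a 1).1 (a 2).1 ∧ IsLineTriple e I.rep (a 3).1 (a 4).1 (a 5).1 ∧
      crossProd (e (a 0).1).2 (e (a 3).1).2 ≠ 0 := by
  obtain ⟨hinj, -, h₁, h₂, hI, hinf⟩ := (mk_mem_PappusISet_iff a).1 ha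
  have hv := hinf.ge (mem_span_singleton_self I.rep)
  have ht₁ := isLineTriple_of_finrank_span_eq_two he h₁ hv.1 (hI 0) (hI 1) (hI 2)
    (hinj _ _ (by decide)) (hinj _ _ (by decide)) (hinj _ _ (by decide))
  have ht₂ := isLineTriple_of_finrank_span_eq_two he h₂ hv.2 (hI 3) (hI 4) (hI 5)
    (hinj _ _ (by decide)) (hinj _ _ (by decide)) (hinj _ _ (by decide))
  refine ⟨ht₁, ht₂, fun h₀ => hI 3 (hinf.le ⟨?_, subset_span (by simp)⟩)⟩
  have hd := eq_smul_add_smul_of_ne_zero ht₁.snd_ne_zero (e (a 3).1).2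
  rw [h₀, zero_div, zero_smul, zero_add] at hd
  have h₃ : (a 3).1 = baseCoeff e (a 0).1 (a 3).1 • (a 0).1 +
      apexCoeff e (a 0).1 (a 3).1 • I.rep := by
    refine e.injective ?_
    rw [map_add, map_smul, map_smul, he]
    refine Prod.ext ?_ ?_
    · simp [apexCoeff]
    · simp only [Prod.snd_add, Prod.smul_snd, smul_zero, add_zero]
      exact hd.symm
  rw [h₃]
  exact add_mem (smul_mem _ _ (subset_span (by simp))) (smul_mem _ _ hv.1)

/-- The normalized representative of the first point of the first line. -/
def PappusModel.fst (m : PappusModel) : Fin 3 → ℂ := e.symm (m.2.1.1, m.1.1.1)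

/-- The normalized representative of the first point of the second line. -/
def PappusModel.snd (m : PappusModel) : Fin 3 → ℂ := e.symm (m.2.1.2, m.1.1.2)

variable {e}

theorem PappusModel.linearIndependent (he : e I.rep = (1, 0)) (m : PappusModel) :
    LinearIndependent ℂ ![m.fst e, m.snd e, I.rep] :=
  linearIndependent_of_crossProd_ne_zero he (by simpa [fst, snd] using m.1.2)

/-- The Pappus configuration with given parameters. -/
def PappusModel.toPappusISet (he : e I.rep = (1, 0)) (m : PappusModel) : PappusISet I :=
  ⟨_, mk_pappusVectors_mem (m.linearIndependent he) m.2.2.1.2 m.2.2.2.2⟩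

theorem PappusModel.continuous_toPappusISet (he : e I.rep = (1, 0)) :
    Continuous (PappusModel.toPappusISet he) := by
  refine .subtype_mk (continuous_pi fun i => ?_) _
  refine (Projectivization.isOpenQuotientMap_mk (K := ℂ)).continuous.comp
    (f := fun m : PappusModel =>
    ⟨pappusVectors I.rep (m.fst e) (m.snd e) m.2.2.1 m.2.2.2 i,
      pappusVectors_ne_zero (m.linearIndependent he) i⟩) (.subtype_mk ?_ _)
  simp only [pappusVectors_eq, fst, snd]
  fun_prop

theorem PappusModel.toPappusISet_injective (he : e I.rep = (1, 0)) :
    Function.Injective (PappusModel.toPappusISet he) := by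
  intro m m' h
  have h' (i : Fin 6) := (Projectivization.mk_eq_mk_iff' ℂ _ _
    (pappusVectors_ne_zero (m.linearIndependent he) i)
    (pappusVectors_ne_zero (m'.linearIndependent he) i)).1 (congrFun (congrArg Subtype.val h) i)
  obtain ⟨hu₁, hz₁⟩ := lineVector_unique he (u := m.fst e) (u' := m'.fst e) (z := m.2.2.1)
    (z' := m'.2.2.1) (fun h₀ => m'.1.2 (by simp_all [fst, crossProd])) (h' 0) (h' 1) (h' 2)
  obtain ⟨hu₂, hz₂⟩ := lineVector_unique he (u := m.snd e) (u' := m'.snd e) (z := m.2.2.2)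
    (z' := m'.2.2.2) (fun h₀ => m'.1.2 (by simp_all [snd, crossProd])) (h' 3) (h' 4) (h' 5)
  have hu₁ := Prod.ext_iff.1 (e.symm.injective hu₁)
  have hu₂ := Prod.ext_iff.1 (e.symm.injective hu₂)
  exact Prod.ext (Subtype.ext (Prod.ext hu₁.2 hu₂.2)) (Prod.ext (Prod.ext hu₁.1 hu₂.1)
    (Prod.ext (Subtype.ext hz₁) (Subtype.ext hz₂)))

/-- The projection from tuples of homogeneous coordinates to tuples of points. -/
def mkTuple (a : Fin 6 → {v : Fin 3 → ℂ // v ≠ 0}) : Fin 6 → CP 2 :=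
  fun i => Projectivization.mk ℂ (a i).1 (a i).2

theorem isOpenQuotientMap_mkTuple : IsOpenQuotientMap mkTuple :=
  IsOpenQuotientMap.piMap fun _ => Projectivization.isOpenQuotientMap_mk

/-- The parameters of a Pappus configuration given in homogeneous coordinates. -/
def PappusModel.ofTuple (he : e I.rep = (1, 0)) (a : mkTuple ⁻¹' PappusISet I) : PappusModel :=
  have h := isLineTriple_of_mem he a.2
  let u₁ := lineVector e (a.1 0).1 (a.1 1).1
  let u₂ := lineVector e (a.1 3).1 (a.1 4).1
  (⟨((e u₁).2, (e u₂).2), by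
    have h₁ := div_ne_zero h.1.base_second h.1.apex_second
    have h₂ := div_ne_zero h.2.1.base_second h.2.1.apex_second
    have h₃ := mul_ne_zero (mul_ne_zero h₁ h₂) h.2.2
    convert h₃ using 1
    simp only [u₁, u₂, lineVector, crossProd, map_smul, Prod.smul_snd, Prod.smul_fst, smul_eq_mul]
    ring⟩, ((e u₁).1, (e u₂).1),
    ⟨lineScalar e (a.1 0).1 (a.1 1).1 (a.1 2).1, h.1.lineScalar_ne_zero, h.1.lineScalar_ne_one⟩,
    ⟨lineScalar e (a.1 3).1 (a.1 4).1 (a.1 5).1, h.2.1.lineScalar_ne_zero,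
      h.2.1.lineScalar_ne_one⟩)

theorem PappusModel.toPappusISet_comp_ofTuple (he : e I.rep = (1, 0)) :
    PappusModel.toPappusISet he ∘ PappusModel.ofTuple he =
      (PappusISet I).restrictPreimage mkTuple := by
  funext a
  obtain ⟨h₁, h₂, -⟩ := isLineTriple_of_mem he a.2
  have hu₁ : (ofTuple he a).fst e = lineVector e (a.1 0).1 (a.1 1).1 := e.symm_apply_apply _
  have hu₂ : (ofTuple he a).snd e = lineVector e (a.1 3).1 (a.1 4).1 := e.symm_apply_apply _
  refine Subtype.ext (funext fun i => (Projectivization.mk_eq_mk_iff' ℂ _ _ _ _).2 ?_)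
  rw [hu₁, hu₂]
  fin_cases i
  · exact ⟨_, rfl⟩
  · exact ⟨_, h₁.lineVector_add.symm⟩
  · exact ⟨_, h₁.lineVector_add_smul.symm⟩
  · exact ⟨_, rfl⟩
  · exact ⟨_, h₂.lineVector_add.symm⟩
  · exact ⟨_, h₂.lineVector_add_smul.symm⟩

theorem PappusModel.continuous_ofTuple (he : e I.rep = (1, 0)) :
    Continuous (PappusModel.ofTuple he) := by
  have hval (i : Fin 6) : Continuous fun a : mkTuple ⁻¹' PappusISet I => (a.1 i).1 :=
    continuous_subtype_val.comp ((continuous_apply i).comp continuous_subtype_val)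
  have hbase {i j : Fin 6} (h : ∀ a : mkTuple ⁻¹' PappusISet I, (e (a.1 i).1).2 ≠ 0) :
      Continuous fun a : mkTuple ⁻¹' PappusISet I => baseCoeff e (a.1 i).1 (a.1 j).1 :=
    .div (by fun_prop) (by fun_prop) fun a => mt hermProd_self_eq_zero.1 (h a)
  have hapex {i j : Fin 6} (h : ∀ a : mkTuple ⁻¹' PappusISet I, (e (a.1 i).1).2 ≠ 0) :
      Continuous fun a : mkTuple ⁻¹' PappusISet I => apexCoeff e (a.1 i).1 (a.1 j).1 :=
    .sub (by fun_prop) ((hbase h).mul (by fun_prop))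
  have hline {i j k : Fin 6} (h : ∀ a : mkTuple ⁻¹' PappusISet I,
      IsLineTriple e I.rep (a.1 i).1 (a.1 j).1 (a.1 k).1) :
      (Continuous fun a : mkTuple ⁻¹' PappusISet I => lineVector e (a.1 i).1 (a.1 j).1) ∧
      Continuous fun a : mkTuple ⁻¹' PappusISet I =>
        lineScalar e (a.1 i).1 (a.1 j).1 (a.1 k).1 := by
    have h₀ := fun a => (h a).snd_ne_zero
    exact ⟨((hbase h₀).div (hapex h₀) fun a => (h a).apex_second).smul (hval i),
      ((hbase h₀).mul (hapex h₀)).div ((hapex h₀).mul (hbase h₀)) fun a =>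
        mul_ne_zero (h a).apex_second (h a).base_third⟩
  obtain ⟨hu₁, hz₁⟩ := hline fun a => (isLineTriple_of_mem he a.2).1
  obtain ⟨hu₂, hz₂⟩ := hline fun a => (isLineTriple_of_mem he a.2).2.1
  have heu₁ := e.continuous.comp hu₁
  have heu₂ := e.continuous.comp hu₂
  exact .prodMk (.subtype_mk (heu₁.snd.prodMk heu₂.snd) _) ((heu₁.fst.prodMk heu₂.fst).prodMk
    (.prodMk (.subtype_mk hz₁ _) (.subtype_mk hz₂ _)))

/-- The parametrization of `𝒫_I` is a homeomorphism. -/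
theorem PappusModel.isHomeomorph_toPappusISet (he : e I.rep = (1, 0)) :
    IsHomeomorph (PappusModel.toPappusISet he) := by
  refine isHomeomorph_iff_isQuotientMap_injective.2 ⟨?_, toPappusISet_injective he⟩
  refine .of_comp (continuous_ofTuple he) (continuous_toPappusISet he) ?_
  rw [toPappusISet_comp_ofTuple]
  exact (isOpenQuotientMap_mkTuple.restrictPreimage _).isQuotientMap

theorem exists_continuousLinearEquiv_rep_eq (I : CP 2) :
    ∃ e : (Fin 3 → ℂ) ≃L[ℂ] ℂ × ℂ × ℂ, e I.rep = (1, 0) := by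
  let e₀ : (Fin 3 → ℂ) ≃L[ℂ] ℂ × ℂ × ℂ := .ofFinrankEq (by simp)
  obtain ⟨A, hA⟩ := SeparatingDual.exists_continuousLinearEquiv_apply_eq (R := ℂ)
    (x := e₀ I.rep) (y := (1, 0)) (by simpa using I.rep_nonzero) (by simp)
  exact ⟨e₀.trans A, hA⟩

theorem nonempty_homeomorph_PappusISet (I : CP 2) :
    Nonempty (PappusISet I ≃ₜ PappusModel) := by
  obtain ⟨e, he⟩ := exists_continuousLinearEquiv_rep_eq I
  exact ⟨(PappusModel.isHomeomorph_toPappusISet he).homeomorph.symm⟩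

end PappusModel

theorem FundamentalGroup.nonempty_PappusModel_mulEquiv (m : PappusModel) :
    Nonempty (FundamentalGroup PappusModel m ≃*
      ((FreeGroup Unit × FreeGroup (Fin 2)) × FreeGroup (Fin 2))) := by
  obtain ⟨p, s, z₁, z₂⟩ := m
  obtain ⟨f₁⟩ := Complex.nonempty_fundamentalGroup_ne_zero_one z₁
  obtain ⟨f₂⟩ := Complex.nonempty_fundamentalGroup_ne_zero_one z₂
  obtain ⟨⟨w, d, t⟩, hq⟩ : ∃ q, independentPairsHomeomorph p = q := ⟨_, rfl⟩
  obtain ⟨f₀⟩ := Complex.nonempty_fundamentalGroup_ne_zero d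
  have : Subsingleton (FundamentalGroup {w : ℂ × ℂ // w ≠ 0} w) :=
    subsingleton_fundamentalGroup_ne_zero (by
      rw [← Module.finrank_eq_rank]
      norm_num [Complex.finrank_real_complex]) w
  have g₀ : FundamentalGroup _ p ≃* FreeGroup Unit := by
    refine (independentPairsHomeomorph.fundamentalGroupMulEquiv p).trans ?_
    rw [hq]
    have : Unique (FundamentalGroup ℂ t) := uniqueOfSubsingleton 1
    exact (prodMulEquivRight w (d, t)).trans ((prodMulEquiv d t).trans
      (MulEquiv.prodUnique.trans f₀))
  exact ⟨(prodMulEquiv _ _).trans ((g₀.prodCongr ((prodMulEquivRight _ _).trans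
    ((prodMulEquiv _ _).trans (f₁.prodCongr f₂)))).trans MulEquiv.prodAssoc.symm)⟩

/-- For every `I ∈ ℂP²`, the fundamental group of the space `𝒫_I` of Pappus
configurations with intersection point `I` is isomorphic to `PB₃ × F₂`. -/
theorem pi1_PappusI (I : CP 2) (x : PappusISet I) :
    Nonempty (FundamentalGroup (PappusISet I) x ≃*
      (PresentedGroup PB3Rels × FreeGroup (Fin 2))) := by
  obtain ⟨f⟩ := nonempty_homeomorph_PappusISet I
  obtain ⟨g⟩ := FundamentalGroup.nonempty_PappusModel_mulEquiv (f x)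
  obtain ⟨b⟩ := nonempty_PB3_mulEquiv
  exact ⟨(f.fundamentalGroupMulEquiv x).trans (g.trans (b.symm.prodCongr (MulEquiv.refl _)))⟩
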